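/- For every Boolean normal monotonic (BNM) scheme 𝕏, the set ST(𝕏) of st-valid inferences over 𝕏 equals the set CL of classically valid inferences. -/

import Mathlib

namespace ThreeValued

/-- Formulas of the propositional language: countably many variables,
negation, conjunction, disjunction. -/
inductive Fml : Type
  | var : ℕ → Fml
  | neg : Fml → Fml
  | conj : Fml → Fml → Fml
  | disj : Fml → Fml → Fml
deriving DecidableEq

/-- An inference Γ ⇒ φ: a finite set of premises and a conclusion. -/
structure Infer : Type where
  prem : Finset Fml
  concl : Fml

/-- A set of inferences is closed under transitivity:
whenever there is a nonempty Δ with Δ ⇒ φ ∈ L and Γ ⇒ δ ∈ L for all δ ∈ Δ,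
then Γ ⇒ φ ∈ L. -/
def TransClosed (L : Set Infer) : Prop :=
  ∀ (Γ Δ : Finset Fml) (φ : Fml), Δ.Nonempty →
    (⟨Δ, φ⟩ : Infer) ∈ L → (∀ δ ∈ Δ, (⟨Γ, δ⟩ : Infer) ∈ L) → (⟨Γ, φ⟩ : Infer) ∈ L

/-- The transitive closure of a set of inferences: the least superset closed
under transitivity. -/
def T (L : Set Infer) : Set Infer := ⋂₀ {L' : Set Infer | L ⊆ L' ∧ TransClosed L'}

/-- A set of inferences is open under dual transitivity:
whenever there is a nonempty Δ with Δ ⇒ φ ∉ L and Γ ⇒ δ ∉ L for all δ ∈ Δ,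
then Γ ⇒ φ ∉ L. -/
def DualTransClosed (L : Set Infer) : Prop :=
  ∀ (Γ Δ : Finset Fml) (φ : Fml), Δ.Nonempty →
    (⟨Δ, φ⟩ : Infer) ∉ L → (∀ δ ∈ Δ, (⟨Γ, δ⟩ : Infer) ∉ L) → (⟨Γ, φ⟩ : Infer) ∉ L

/-- The dual transitive closure: the greatest subset open under dual
transitivity. -/
def Td (L : Set Infer) : Set Infer := ⋃₀ {L' : Set Infer | L' ⊆ L ∧ DualTransClosed L'}

/-- The three truth values 0, 1/2, 1. -/
inductive V3 : Type
  | zero | half | one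
deriving DecidableEq

/-- A three-valued scheme: a triple of truth functions for ¬, ∧ and ∨. -/
structure Scheme : Type where
  fneg : V3 → V3
  fconj : V3 → V3 → V3
  fdisj : V3 → V3 → V3

/-- Boolean normality: on Boolean inputs the operations agree with the
classical ones. -/
def BooleanNormal (X : Scheme) : Prop :=
  X.fneg .zero = .one ∧ X.fneg .one = .zero ∧
  X.fconj .one .one = .one ∧ X.fconj .one .zero = .zero ∧
  X.fconj .zero .one = .zero ∧ X.fconj .zero .zero = .zero ∧
  X.fdisj .one .one = .one ∧ X.fdisj .one .zero = .one ∧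
  X.fdisj .zero .one = .one ∧ X.fdisj .zero .zero = .zero

/-- The information order: 1/2 is below 0 and below 1. -/
def infLe (a b : V3) : Prop := a = .half ∨ a = b

/-- Monotonicity of a scheme with respect to the information order. -/
def Monotonic (X : Scheme) : Prop :=
  (∀ a b, infLe a b → infLe (X.fneg a) (X.fneg b)) ∧
  (∀ a₁ a₂ b₁ b₂, infLe a₁ b₁ → infLe a₂ b₂ → infLe (X.fconj a₁ a₂) (X.fconj b₁ b₂)) ∧
  (∀ a₁ a₂ b₁ b₂, infLe a₁ b₁ → infLe a₂ b₂ → infLe (X.fdisj a₁ a₂) (X.fdisj b₁ b₂))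

/-- Boolean normal monotonic schemes. -/
def BNM (X : Scheme) : Prop := BooleanNormal X ∧ Monotonic X

/-- Valuations respecting a scheme. -/
def Respects (X : Scheme) (v : Fml → V3) : Prop :=
  (∀ φ, v (.neg φ) = X.fneg (v φ)) ∧
  (∀ φ ψ, v (.conj φ ψ) = X.fconj (v φ) (v ψ)) ∧
  (∀ φ ψ, v (.disj φ ψ) = X.fdisj (v φ) (v ψ))

/-- The strict formula-standard s = {1}. -/
def sStd : Set V3 := {.one}

/-- The tolerant formula-standard t = {1, 1/2}. -/
def tStd : Set V3 := {.one, .half}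

/-- An inference is xy-valid over a scheme X if every valuation respecting X
whose value on each premise is in x gives the conclusion a value in y. -/
def Valid (X : Scheme) (x y : Set V3) (I : Infer) : Prop :=
  ∀ v : Fml → V3, Respects X v → (∀ γ ∈ I.prem, v γ ∈ x) → v I.concl ∈ y

/-- The ss-valid inferences over X. -/
def SS (X : Scheme) : Set Infer := {I | Valid X sStd sStd I}

/-- The tt-valid inferences over X. -/
def TT (X : Scheme) : Set Infer := {I | Valid X tStd tStd I}

/-- The st-valid inferences over X. -/
def ST (X : Scheme) : Set Infer := {I | Valid X sStd tStd I}

/-- The ts-valid inferences over X. -/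
def TS (X : Scheme) : Set Infer := {I | Valid X tStd sStd I}

/-- Classical two-valued valuations. -/
def RespectsCL (v : Fml → Bool) : Prop :=
  (∀ φ, v (.neg φ) = ! v φ) ∧
  (∀ φ ψ, v (.conj φ ψ) = (v φ && v ψ)) ∧
  (∀ φ ψ, v (.disj φ ψ) = (v φ || v ψ))

/-- The classically valid inferences. -/
def CL : Set Infer :=
  {I | ∀ v : Fml → Bool, RespectsCL v → (∀ γ ∈ I.prem, v γ = true) → v I.concl = true}

/-- Substitution: the homomorphic extension of a map from variables to
formulas. -/
def subst (σ : ℕ → Fml) : Fml → Fml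
  | .var n => σ n
  | .neg φ => .neg (subst σ φ)
  | .conj φ ψ => .conj (subst σ φ) (subst σ ψ)
  | .disj φ ψ => .disj (subst σ φ) (subst σ ψ)

/-- Reflexivity. -/
def PropR (L : Set Infer) : Prop := ∀ φ : Fml, (⟨{φ}, φ⟩ : Infer) ∈ L

/-- Monotonicity (weakening). -/
def PropM (L : Set Infer) : Prop :=
  ∀ (Γ Sg : Finset Fml) (φ : Fml), (⟨Γ, φ⟩ : Infer) ∈ L → Γ ⊆ Sg → (⟨Sg, φ⟩ : Infer) ∈ L

/-- Structurality (closure under substitutions). -/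
def PropS (L : Set Infer) : Prop :=
  ∀ (Γ : Finset Fml) (φ : Fml), (⟨Γ, φ⟩ : Infer) ∈ L →
    ∀ σ : ℕ → Fml, (⟨Γ.image (subst σ), subst σ φ⟩ : Infer) ∈ L

/-- The Tarskian closure: the least superset satisfying (R), (M), (T), (S). -/
def Tar (L : Set Infer) : Set Infer :=
  ⋂₀ {L' : Set Infer | L ⊆ L' ∧ PropR L' ∧ PropM L' ∧ TransClosed L' ∧ PropS L'}

/-- L⋆: the inferences whose premise set is an antitheorem of L or whose
conclusion is a theorem of L. -/
def starL (L : Set Infer) : Set Infer :=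
  {I | (∀ ψ : Fml, (⟨I.prem, ψ⟩ : Infer) ∈ L) ∨ (∀ Δ : Finset Fml, (⟨Δ, I.concl⟩ : Infer) ∈ L)}

/-- The propositional variables occurring in a formula. -/
def fvars : Fml → Finset ℕ
  | .var n => {n}
  | .neg φ => fvars φ
  | .conj φ ψ => fvars φ ∪ fvars ψ
  | .disj φ ψ => fvars φ ∪ fvars ψ

/-- The inclusion of the classical truth values into the three truth values. -/
def V3.ofBool : Bool → V3
  | true => .one
  | false => .zero

/-- The classical valuation determined by an assignment to the variables. -/
def classicalEval (a : ℕ → Bool) : Fml → Bool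
  | .var n => a n
  | .neg φ => ! classicalEval a φ
  | .conj φ ψ => classicalEval a φ && classicalEval a ψ
  | .disj φ ψ => classicalEval a φ || classicalEval a ψ

theorem respectsCL_classicalEval (a : ℕ → Bool) : RespectsCL (classicalEval a) :=
  ⟨fun _ => rfl, fun _ _ => rfl, fun _ _ => rfl⟩

theorem BooleanNormal.fneg_ofBool {X : Scheme} (h : BooleanNormal X) (b : Bool) :
    X.fneg (.ofBool b) = .ofBool (!b) := by
  obtain ⟨h0, h1, -⟩ := h
  cases b <;> assumption

theorem BooleanNormal.fconj_ofBool {X : Scheme} (h : BooleanNormal X) (b c : Bool) :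
    X.fconj (.ofBool b) (.ofBool c) = .ofBool (b && c) := by
  obtain ⟨-, -, h11, h10, h01, h00, -⟩ := h
  cases b <;> cases c <;> assumption

theorem BooleanNormal.fdisj_ofBool {X : Scheme} (h : BooleanNormal X) (b c : Bool) :
    X.fdisj (.ofBool b) (.ofBool c) = .ofBool (b || c) := by
  obtain ⟨-, -, -, -, -, -, h11, h10, h01, h00⟩ := h
  cases b <;> cases c <;> assumption

/-- Classical valuations are three-valued valuations of any Boolean normal scheme. -/
theorem BooleanNormal.respects_ofBool {X : Scheme} (h : BooleanNormal X) {v : Fml → Bool}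
    (hv : RespectsCL v) : Respects X fun φ => .ofBool (v φ) := by
  refine ⟨fun φ => ?_, fun φ ψ => ?_, fun φ ψ => ?_⟩
  · simp only [hv.1, h.fneg_ofBool]
  · simp only [hv.2.1, h.fconj_ofBool]
  · simp only [hv.2.2, h.fdisj_ofBool]

/-- If a classical assignment refines a three-valued valuation on the variables, then it does
so on every formula. -/
theorem BNM.infLe_classicalEval {X : Scheme} (h : BNM X) {v : Fml → V3} (hv : Respects X v)
    {a : ℕ → Bool} (ha : ∀ n, infLe (v (.var n)) (.ofBool (a n))) (φ : Fml) :
    infLe (v φ) (.ofBool (classicalEval a φ)) := by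
  obtain ⟨hn, hneg, hconj, hdisj⟩ := h
  induction φ with
  | var n => exact ha n
  | neg φ ih =>
    rw [hv.1, classicalEval, ← hn.fneg_ofBool]
    exact hneg _ _ ih
  | conj φ ψ ihφ ihψ =>
    rw [hv.2.1, classicalEval, ← hn.fconj_ofBool]
    exact hconj _ _ _ _ ihφ ihψ
  | disj φ ψ ihφ ihψ =>
    rw [hv.2.2, classicalEval, ← hn.fdisj_ofBool]
    exact hdisj _ _ _ _ ihφ ihψ

theorem infLe_ofBool_decide (x : V3) : infLe x (.ofBool (decide (x = .one))) := by
  cases x <;> simp [infLe, V3.ofBool]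

theorem eq_true_of_infLe_one {b : Bool} (h : infLe .one (.ofBool b)) : b = true := by
  cases b <;> simp_all [infLe, V3.ofBool]

theorem mem_tStd_of_infLe_one {x : V3} (h : infLe x .one) : x ∈ tStd := by
  cases x <;> simp_all [infLe, tStd]

theorem ofBool_mem_sStd {b : Bool} : V3.ofBool b ∈ sStd ↔ b = true := by
  cases b <;> simp [sStd, V3.ofBool]

theorem ofBool_mem_tStd {b : Bool} : V3.ofBool b ∈ tStd ↔ b = true := by
  cases b <;> simp [tStd, V3.ofBool]

/-- For every BNM scheme, ST coincides with classical logic. -/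
theorem stmt3 : ∀ X : Scheme, BNM X → ST X = CL := by
  intro X hX
  ext I
  constructor
  · intro hI v hv hprem
    exact ofBool_mem_tStd.1
      (hI _ (hX.1.respects_ofBool hv) fun γ hγ => ofBool_mem_sStd.2 (hprem γ hγ))
  · intro hI v hv hprem
    have href := hX.infLe_classicalEval hv fun n => infLe_ofBool_decide (v (.var n))
    have hconcl := hI _ (respectsCL_classicalEval _) fun γ hγ => by
      have hγ' := href γ
      rw [show v γ = .one from hprem γ hγ] at hγ'
      exact eq_true_of_infLe_one hγ'
    have hφ := href I.concl
    rw [hconcl] at hφ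
    exact mem_tStd_of_infLe_one hφ

end ThreeValued
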